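/- Let R be a commutative ring, w ∈ R, and let E and F be matrix factorizations of w over R. Then Supp(E ⊗ F) = Supp(E) ∩ Supp(F) as subsets of Spec R, where E ⊗ F is a matrix factorization of 2w over R. -/

import Mathlib

open Matrix Kronecker

structure MF (R : Type) [CommRing R] : Type 1 where
  ι1 : Type
  ι0 : Type
  [fin1 : Fintype ι1]
  [fin0 : Fintype ι0]
  [dec1 : DecidableEq ι1]
  [dec0 : DecidableEq ι0]
  A : Matrix ι0 ι1 R
  B : Matrix ι1 ι0 R

attribute [instance] MF.fin1 MF.fin0 MF.dec1 MF.dec0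

namespace MF

variable {R S : Type} [CommRing R] [CommRing S]

def IsMF (w : R) (F : MF R) : Prop :=
  F.B * F.A = w • (1 : Matrix F.ι1 F.ι1 R) ∧ F.A * F.B = w • (1 : Matrix F.ι0 F.ι0 R)

def Contractible (F : MF R) : Prop :=
  ∃ (h0 : Matrix F.ι1 F.ι0 R) (h1 : Matrix F.ι0 F.ι1 R),
    (1 : Matrix F.ι0 F.ι0 R) = F.A * h0 + h1 * F.B ∧
    (1 : Matrix F.ι1 F.ι1 R) = F.B * h1 + h0 * F.A

def map (f : R →+* S) (F : MF R) : MF S where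
  ι1 := F.ι1
  ι0 := F.ι0
  A := F.A.map f
  B := F.B.map f

def Supp (F : MF R) : Set (PrimeSpectrum R) :=
  { p | ¬ Contractible (F.map (algebraMap R (Localization.AtPrime p.asIdeal))) }

/-- The tensor product of two matrix factorizations (of `v` and `w`), a matrix
factorization of `v + w`, with `(E⊗F)₁ = (E₁⊗F₀) ⊕ (E₀⊗F₁)`,
`(E⊗F)₀ = (E₀⊗F₀) ⊕ (E₁⊗F₁)` and the usual sign conventions. -/
def tensor (E F : MF R) : MF R where
  ι1 := (E.ι1 × F.ι0) ⊕ (E.ι0 × F.ι1)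
  ι0 := (E.ι0 × F.ι0) ⊕ (E.ι1 × F.ι1)
  A := Matrix.fromBlocks
        (E.A ⊗ₖ (1 : Matrix F.ι0 F.ι0 R)) ((1 : Matrix E.ι0 E.ι0 R) ⊗ₖ F.A)
        (-((1 : Matrix E.ι1 E.ι1 R) ⊗ₖ F.B)) (E.B ⊗ₖ (1 : Matrix F.ι1 F.ι1 R))
  B := Matrix.fromBlocks
        (E.B ⊗ₖ (1 : Matrix F.ι0 F.ι0 R)) (-((1 : Matrix E.ι1 E.ι1 R) ⊗ₖ F.A))
        ((1 : Matrix E.ι0 E.ι0 R) ⊗ₖ F.B) (E.A ⊗ₖ (1 : Matrix F.ι1 F.ι1 R))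

/-- A morphism of matrix factorizations, given by the two component matrices
`f1 : E₁ → F₁` and `f0 : E₀ → F₀`. -/
structure Hom (E F : MF R) : Type where
  f1 : Matrix F.ι1 E.ι1 R
  f0 : Matrix F.ι0 E.ι0 R

/-- The pair `(f1, f0)` commutes with the structure maps. -/
def Hom.IsHom {E F : MF R} (f : Hom E F) : Prop :=
  f.f0 * E.A = F.A * f.f1 ∧ f.f1 * E.B = F.B * f.f0

/-- Null-homotopic morphisms of matrix factorizations. -/
def Hom.NullHomotopic {E F : MF R} (f : Hom E F) : Prop :=
  ∃ (h0 : Matrix F.ι1 E.ι0 R) (h1 : Matrix F.ι0 E.ι1 R),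
    f.f0 = F.A * h0 + h1 * E.B ∧ f.f1 = F.B * h1 + h0 * E.A

/-- Base change of a morphism of matrix factorizations. -/
def Hom.map (φ : R →+* S) {E F : MF R} (f : Hom E F) : Hom (E.map φ) (F.map φ) where
  f1 := f.f1.map φ
  f0 := f.f0.map φ

/-- The identity morphism. -/
def Hom.id (F : MF R) : Hom F F where
  f1 := 1
  f0 := 1

/-- Composition of morphisms. -/
def Hom.comp {E F G : MF R} (g : Hom F G) (f : Hom E F) : Hom E G where
  f1 := g.f1 * f.f1
  f0 := g.f0 * f.f0

/-- Two morphisms are homotopic if their difference is null-homotopic. -/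
def Hom.Homotopic {E F : MF R} (f g : Hom E F) : Prop :=
  Hom.NullHomotopic (⟨f.f1 - g.f1, f.f0 - g.f0⟩ : Hom E F)

/-- The tensor product of two morphisms of matrix factorizations. -/
def Hom.tensor {E E' F F' : MF R} (f : Hom E E') (g : Hom F F') :
    Hom (E.tensor F) (E'.tensor F') where
  f1 := Matrix.fromBlocks (f.f1 ⊗ₖ g.f0) 0 0 (f.f0 ⊗ₖ g.f1)
  f0 := Matrix.fromBlocks (f.f0 ⊗ₖ g.f0) 0 0 (f.f1 ⊗ₖ g.f1)

/-- `pow1 E n` is the `(n+1)`-fold tensor power `E^{⊗(n+1)}`. -/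
def pow1 (E : MF R) : ℕ → MF R
  | 0 => E
  | n + 1 => (pow1 E n).tensor E

/-- `Hom.pow1 f n` is the `(n+1)`-fold tensor power `f^{⊗(n+1)}` of a morphism. -/
def Hom.pow1 {E F : MF R} (f : Hom E F) : (n : ℕ) → Hom (E.pow1 n) (F.pow1 n)
  | 0 => f
  | n + 1 => (Hom.pow1 f n).tensor f

end MF

namespace MF

variable {R S : Type} [CommRing R] [CommRing S]

theorem IsMF.map {w : R} {F : MF R} (hF : F.IsMF w) (f : R →+* S) :
    (F.map f).IsMF (f w) := by
  refine ⟨?_, ?_⟩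
  · change F.B.map f * F.A.map f = f w • (1 : Matrix F.ι1 F.ι1 S)
    rw [← Matrix.map_mul, hF.1]
    ext i j
    simp [Matrix.one_apply, apply_ite f]
  · change F.A.map f * F.B.map f = f w • (1 : Matrix F.ι0 F.ι0 S)
    rw [← Matrix.map_mul, hF.2]
    ext i j
    simp [Matrix.one_apply, apply_ite f]

theorem Contractible.map {F : MF R} (hF : F.Contractible) (f : R →+* S) :
    (F.map f).Contractible := by
  obtain ⟨h0, h1, e0, e1⟩ := hF
  refine ⟨h0.map f, h1.map f, ?_, ?_⟩
  · change (1 : Matrix F.ι0 F.ι0 S) = F.A.map f * h0.map f + h1.map f * F.B.map f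
    rw [← Matrix.map_mul, ← Matrix.map_mul, ← Matrix.map_add f (map_add f), ← e0,
      Matrix.map_one f (map_zero f) (map_one f)]
  · change (1 : Matrix F.ι1 F.ι1 S) = F.B.map f * h1.map f + h0.map f * F.A.map f
    rw [← Matrix.map_mul, ← Matrix.map_mul, ← Matrix.map_add f (map_add f), ← e1,
      Matrix.map_one f (map_zero f) (map_one f)]

theorem map_tensor (E F : MF R) (f : R →+* S) :
    (E.tensor F).map f = (E.map f).tensor (F.map f) := by
  have hneg {m n : Type} (M : Matrix m n R) : (-M).map f = -M.map f := by
    ext; simp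
  have hk {l m n p : Type} (M : Matrix l m R) (N : Matrix n p R) :
      (M ⊗ₖ N).map f = M.map f ⊗ₖ N.map f := by
    ext; simp
  simp only [tensor, MF.map, Matrix.fromBlocks_map, hneg, hk,
    Matrix.map_one f (map_zero f) (map_one f)]
  rfl

section Mk

variable {m n : Type} [Fintype m] [Fintype n] [DecidableEq m] [DecidableEq n]
  {A : Matrix n m R} {B : Matrix m n R}

theorem contractible_mk (h0 : Matrix m n R) (h1 : Matrix n m R) (e0 : 1 = A * h0 + h1 * B)
    (e1 : 1 = B * h1 + h0 * A) : (MF.mk m n A B).Contractible :=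
  ⟨h0, h1, e0, e1⟩

/-- There are cycles `X` and cocycles `Y` in degree zero that pair nontrivially. -/
def HasClassZero (F : MF R) : Prop :=
  ∃ (p : Type) (X : Matrix F.ι0 p R) (Y : Matrix p F.ι0 R),
    F.B * X = 0 ∧ Y * F.A = 0 ∧ Y * X ≠ 0

/-- There are cycles `X` and cocycles `Y` in degree one that pair nontrivially. -/
def HasClassOne (F : MF R) : Prop :=
  ∃ (p : Type) (X : Matrix F.ι1 p R) (Y : Matrix p F.ι1 R),
    F.A * X = 0 ∧ Y * F.B = 0 ∧ Y * X ≠ 0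

theorem hasClassZero_mk {p : Type} (X : Matrix n p R) (Y : Matrix p n R) (hX : B * X = 0)
    (hY : Y * A = 0) (h : Y * X ≠ 0) : (MF.mk m n A B).HasClassZero :=
  ⟨p, X, Y, hX, hY, h⟩

theorem hasClassOne_mk {p : Type} (X : Matrix m p R) (Y : Matrix p m R) (hX : A * X = 0)
    (hY : Y * B = 0) (h : Y * X ≠ 0) : (MF.mk m n A B).HasClassOne :=
  ⟨p, X, Y, hX, hY, h⟩

end Mk

theorem Contractible.tensor_left {E : MF R} (hE : E.Contractible) (F : MF R) :
    (E.tensor F).Contractible := by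
  obtain ⟨h0, h1, e0, e1⟩ := hE
  refine contractible_mk (Matrix.fromBlocks (h0 ⊗ₖ (1 : Matrix F.ι0 F.ι0 R)) 0 0
      (h1 ⊗ₖ (1 : Matrix F.ι1 F.ι1 R)))
    (Matrix.fromBlocks (h1 ⊗ₖ (1 : Matrix F.ι0 F.ι0 R)) 0 0
      (h0 ⊗ₖ (1 : Matrix F.ι1 F.ι1 R))) ?_ ?_ <;>
  · simp only [Matrix.fromBlocks_multiply, Matrix.fromBlocks_add, Matrix.mul_zero,
      Matrix.zero_mul, Matrix.neg_mul, Matrix.mul_neg, ← Matrix.mul_kronecker_mul,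
      Matrix.one_mul, Matrix.mul_one, add_zero, zero_add, ← Matrix.add_kronecker,
      neg_zero, add_neg_cancel, neg_add_cancel]
    simp only [← e0, ← e1, Matrix.one_kronecker_one,
      Matrix.fromBlocks_one]

theorem Contractible.tensor_right (E : MF R) {F : MF R} (hF : F.Contractible) :
    (E.tensor F).Contractible := by
  obtain ⟨h0, h1, e0, e1⟩ := hF
  refine contractible_mk (Matrix.fromBlocks 0 (-((1 : Matrix E.ι1 E.ι1 R) ⊗ₖ h1))
      ((1 : Matrix E.ι0 E.ι0 R) ⊗ₖ h0) 0)
    (Matrix.fromBlocks 0 ((1 : Matrix E.ι0 E.ι0 R) ⊗ₖ h1)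
      (-((1 : Matrix E.ι1 E.ι1 R) ⊗ₖ h0)) 0) ?_ ?_ <;>
  · simp only [Matrix.fromBlocks_multiply, Matrix.fromBlocks_add, Matrix.mul_zero,
      Matrix.zero_mul, Matrix.neg_mul, Matrix.mul_neg, neg_neg, ← Matrix.mul_kronecker_mul,
      Matrix.one_mul, Matrix.mul_one, add_zero, zero_add, ← Matrix.kronecker_add,
      neg_zero, add_neg_cancel, neg_add_cancel]
    simp only [← e0, ← e1, Matrix.one_kronecker_one,
      Matrix.fromBlocks_one]

/-- A null-homotopic endomorphism whose components are invertible contracts a matrix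
factorization. -/
theorem IsMF.contractible_of_isUnit {w : R} {F : MF R} (hF : F.IsMF w)
    (h0 : Matrix F.ι1 F.ι0 R) (h1 : Matrix F.ι0 F.ι1 R)
    (u0 : IsUnit (F.A * h0 + h1 * F.B)) (u1 : IsUnit (F.B * h1 + h0 * F.A)) :
    F.Contractible := by
  obtain ⟨u0, hu0⟩ := u0
  obtain ⟨u1, hu1⟩ := u1
  have hA : (u0 : Matrix F.ι0 F.ι0 R) * F.A = F.A * (u1 : Matrix F.ι1 F.ι1 R) := by
    rw [hu0, hu1, Matrix.add_mul, Matrix.mul_add, Matrix.mul_assoc h1, hF.1,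
      ← Matrix.mul_assoc F.A F.B, hF.2, Matrix.mul_assoc F.A]
    simp [add_comm]
  have hB : (u1 : Matrix F.ι1 F.ι1 R) * F.B = F.B * (u0 : Matrix F.ι0 F.ι0 R) := by
    rw [hu0, hu1, Matrix.add_mul, Matrix.mul_add, Matrix.mul_assoc h0, hF.2,
      ← Matrix.mul_assoc F.B F.A, hF.1, Matrix.mul_assoc F.B]
    simp [add_comm]
  have inv0 : (↑u0⁻¹ : Matrix F.ι0 F.ι0 R) * (u0 : Matrix F.ι0 F.ι0 R) = 1 := u0.inv_mul
  have inv1 : (↑u1⁻¹ : Matrix F.ι1 F.ι1 R) * (u1 : Matrix F.ι1 F.ι1 R) = 1 := u1.inv_mul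
  have inv0' : (u0 : Matrix F.ι0 F.ι0 R) * (↑u0⁻¹ : Matrix F.ι0 F.ι0 R) = 1 := u0.mul_inv
  have inv1' : (u1 : Matrix F.ι1 F.ι1 R) * (↑u1⁻¹ : Matrix F.ι1 F.ι1 R) = 1 := u1.mul_inv
  have hA' : F.A * (↑u1⁻¹ : Matrix F.ι1 F.ι1 R) = (↑u0⁻¹ : Matrix F.ι0 F.ι0 R) * F.A := by
    rw [← Matrix.one_mul (F.A * _), ← inv0, Matrix.mul_assoc, ← Matrix.mul_assoc _ F.A, hA,
      Matrix.mul_assoc F.A, inv1', Matrix.mul_one]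
  have hB' : F.B * (↑u0⁻¹ : Matrix F.ι0 F.ι0 R) = (↑u1⁻¹ : Matrix F.ι1 F.ι1 R) * F.B := by
    rw [← Matrix.one_mul (F.B * _), ← inv1, Matrix.mul_assoc, ← Matrix.mul_assoc _ F.B, hB,
      Matrix.mul_assoc F.B, inv0', Matrix.mul_one]
  refine ⟨(↑u1⁻¹ : Matrix F.ι1 F.ι1 R) * h0, (↑u0⁻¹ : Matrix F.ι0 F.ι0 R) * h1, ?_, ?_⟩
  · rw [← Matrix.mul_assoc, hA', Matrix.mul_assoc, Matrix.mul_assoc, ← Matrix.mul_add, ← hu0,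
      inv0]
  · rw [← Matrix.mul_assoc, hB', Matrix.mul_assoc, Matrix.mul_assoc, ← Matrix.mul_add, ← hu1,
      inv1]

theorem isUnit_of_map_eq_one {n : Type} [Fintype n] [DecidableEq n] (f : R →+* S)
    [IsLocalHom f] {M : Matrix n n R} (h : M.map f = 1) : IsUnit M := by
  rw [Matrix.isUnit_iff_isUnit_det]
  apply isUnit_of_map_unit f
  rw [RingHom.map_det, RingHom.mapMatrix_apply, h, Matrix.det_one]
  exact isUnit_one

theorem IsMF.contractible_of_map {w : R} {F : MF R} (hF : F.IsMF w) (f : R →+* S)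
    [IsLocalHom f] (hf : Function.Surjective f) (h : (F.map f).Contractible) :
    F.Contractible := by
  have lift {m n : Type} (M : Matrix m n S) : ∃ N : Matrix m n R, N.map f = M := by
    choose g hg using hf
    exact ⟨M.map g, by ext; simp [hg]⟩
  obtain ⟨k0, k1, e0, e1⟩ := h
  obtain ⟨h0, rfl⟩ := lift (m := F.ι1) (n := F.ι0) k0
  obtain ⟨h1, rfl⟩ := lift (m := F.ι0) (n := F.ι1) k1
  refine hF.contractible_of_isUnit h0 h1 (isUnit_of_map_eq_one f ?_) (isUnit_of_map_eq_one f ?_)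
  · rw [Matrix.map_add f (map_add f), Matrix.map_mul, Matrix.map_mul]
    exact e0.symm
  · rw [Matrix.map_add f (map_add f), Matrix.map_mul, Matrix.map_mul]
    exact e1.symm

/-- Every matrix over a field has a generalized inverse. -/
theorem exists_mul_mul_eq_self {K m n : Type} [Field K] [Fintype m] [Fintype n]
    (A : Matrix m n K) : ∃ G : Matrix n m K, A * G * A = A := by
  classical
  obtain ⟨s, hs⟩ := A.toLin'.rangeRestrict.exists_rightInverse_of_surjective
    A.toLin'.range_rangeRestrict
  obtain ⟨g, hg⟩ := LinearMap.exists_extend s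
  refine ⟨LinearMap.toMatrix' g, Matrix.toLin'.injective ?_⟩
  refine LinearMap.ext fun x => ?_
  have h1 : g (A.toLin' x) = s (A.toLin'.rangeRestrict x) :=
    LinearMap.congr_fun hg (A.toLin'.rangeRestrict x)
  have h2 := congrArg Subtype.val (LinearMap.congr_fun hs (A.toLin'.rangeRestrict x))
  simp only [Matrix.toLin'_mul, Matrix.toLin'_toMatrix', LinearMap.comp_apply, h1]
  exact h2

theorem HasClassZero.not_contractible {F : MF R} (h : F.HasClassZero) : ¬ F.Contractible := by
  rintro ⟨h0, h1, e0, -⟩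
  obtain ⟨p, X, Y, hX, hY, hne⟩ := h
  apply hne
  rw [← Matrix.mul_one Y, e0, Matrix.mul_add, Matrix.add_mul, ← Matrix.mul_assoc Y, hY,
    ← Matrix.mul_assoc Y, Matrix.mul_assoc _ F.B, hX]
  simp

theorem HasClassOne.not_contractible {F : MF R} (h : F.HasClassOne) : ¬ F.Contractible := by
  rintro ⟨h0, h1, -, e1⟩
  obtain ⟨p, X, Y, hX, hY, hne⟩ := h
  apply hne
  rw [← Matrix.mul_one Y, e1, Matrix.mul_add, Matrix.add_mul, ← Matrix.mul_assoc Y, hY,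
    ← Matrix.mul_assoc Y, Matrix.mul_assoc _ F.A, hX]
  simp

section Field

variable {K : Type} [Field K]

theorem hasClass_of_not_contractible {F : MF K} (hF : F.IsMF 0) (h : ¬ F.Contractible) :
    F.HasClassZero ∨ F.HasClassOne := by
  obtain ⟨hBA, hAB⟩ := hF
  rw [zero_smul] at hBA hAB
  obtain ⟨g, hg⟩ := exists_mul_mul_eq_self F.A
  obtain ⟨k, hk⟩ := exists_mul_mul_eq_self F.B
  by_contra! hcon
  obtain ⟨hc0, hc1⟩ := hcon
  have z0 : (1 - F.A * g) * (1 - k * F.B) = 0 := by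
    by_contra hne
    refine hc0 ⟨F.ι0, 1 - k * F.B, 1 - F.A * g, ?_, ?_, hne⟩
    · rw [Matrix.mul_sub, Matrix.mul_one, ← Matrix.mul_assoc, hk, sub_self]
    · rw [Matrix.sub_mul, Matrix.one_mul, hg, sub_self]
  have z1 : (1 - F.B * k) * (1 - g * F.A) = 0 := by
    by_contra hne
    refine hc1 ⟨F.ι1, 1 - g * F.A, 1 - F.B * k, ?_, ?_, hne⟩
    · rw [Matrix.mul_sub, Matrix.mul_one, ← Matrix.mul_assoc, hg, sub_self]
    · rw [Matrix.sub_mul, Matrix.one_mul, hk, sub_self]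
  refine h ⟨g * (1 - k * F.B), k * (1 - g * F.A), ?_, ?_⟩
  · rw [Matrix.sub_mul, Matrix.one_mul, sub_eq_zero] at z0
    rw [← Matrix.mul_assoc, ← z0, Matrix.mul_assoc k, Matrix.sub_mul, Matrix.mul_assoc g, hAB]
    simp
  · rw [Matrix.sub_mul, Matrix.one_mul, sub_eq_zero] at z1
    rw [← Matrix.mul_assoc, ← z1, Matrix.mul_assoc g, Matrix.sub_mul, Matrix.mul_assoc k, hBA]
    simp

theorem kronecker_ne_zero {l m n p : Type} {M : Matrix l m K} {N : Matrix n p K}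
    (hM : M ≠ 0) (hN : N ≠ 0) : M ⊗ₖ N ≠ 0 := by
  contrapose! hM
  obtain ⟨i, j, hij⟩ : ∃ i j, N i j ≠ 0 := by
    by_contra! h
    exact hN (Matrix.ext h)
  ext a b
  have := congrFun₂ hM (a, i) (b, j)
  simpa [hij] using this

theorem HasClassZero.tensor_zero {E F : MF K} (hE : E.HasClassZero) (hF : F.HasClassZero) :
    (E.tensor F).HasClassZero := by
  obtain ⟨p, X, Y, hX, hY, hne⟩ := hE
  obtain ⟨q, X', Y', hX', hY', hne'⟩ := hF
  refine hasClassZero_mk (Matrix.fromRows (X ⊗ₖ X') 0) (Matrix.fromCols (Y ⊗ₖ Y') 0) ?_ ?_ ?_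
  · simp [Matrix.fromBlocks_mul_fromRows, ← Matrix.mul_kronecker_mul, hX, hX']
  · simp [Matrix.fromCols_mul_fromBlocks, ← Matrix.mul_kronecker_mul, hY, hY']
  · simpa [Matrix.fromCols_mul_fromRows, ← Matrix.mul_kronecker_mul] using
      kronecker_ne_zero hne hne'

theorem HasClassOne.tensor_one {E F : MF K} (hE : E.HasClassOne) (hF : F.HasClassOne) :
    (E.tensor F).HasClassZero := by
  obtain ⟨p, X, Y, hX, hY, hne⟩ := hE
  obtain ⟨q, X', Y', hX', hY', hne'⟩ := hF
  refine hasClassZero_mk (Matrix.fromRows 0 (X ⊗ₖ X')) (Matrix.fromCols 0 (Y ⊗ₖ Y')) ?_ ?_ ?_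
  · simp [Matrix.fromBlocks_mul_fromRows, ← Matrix.mul_kronecker_mul, hX, hX']
  · simp [Matrix.fromCols_mul_fromBlocks, ← Matrix.mul_kronecker_mul, hY, hY']
  · simpa [Matrix.fromCols_mul_fromRows, ← Matrix.mul_kronecker_mul] using
      kronecker_ne_zero hne hne'

theorem HasClassOne.tensor_zero {E F : MF K} (hE : E.HasClassOne) (hF : F.HasClassZero) :
    (E.tensor F).HasClassOne := by
  obtain ⟨p, X, Y, hX, hY, hne⟩ := hE
  obtain ⟨q, X', Y', hX', hY', hne'⟩ := hF
  refine hasClassOne_mk (Matrix.fromRows (X ⊗ₖ X') 0) (Matrix.fromCols (Y ⊗ₖ Y') 0) ?_ ?_ ?_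
  · simp [Matrix.fromBlocks_mul_fromRows, ← Matrix.mul_kronecker_mul, hX, hX']
  · simp [Matrix.fromCols_mul_fromBlocks, ← Matrix.mul_kronecker_mul, hY, hY']
  · simpa [Matrix.fromCols_mul_fromRows, ← Matrix.mul_kronecker_mul] using
      kronecker_ne_zero hne hne'

theorem HasClassZero.tensor_one {E F : MF K} (hE : E.HasClassZero) (hF : F.HasClassOne) :
    (E.tensor F).HasClassOne := by
  obtain ⟨p, X, Y, hX, hY, hne⟩ := hE
  obtain ⟨q, X', Y', hX', hY', hne'⟩ := hF
  refine hasClassOne_mk (Matrix.fromRows 0 (X ⊗ₖ X')) (Matrix.fromCols 0 (Y ⊗ₖ Y')) ?_ ?_ ?_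
  · simp [Matrix.fromBlocks_mul_fromRows, ← Matrix.mul_kronecker_mul, hX, hX']
  · simp [Matrix.fromCols_mul_fromBlocks, ← Matrix.mul_kronecker_mul, hY, hY']
  · simpa [Matrix.fromCols_mul_fromRows, ← Matrix.mul_kronecker_mul] using
      kronecker_ne_zero hne hne'

theorem IsMF.contractible_of_ne_zero {w : K} {F : MF K} (hF : F.IsMF w) (hw : w ≠ 0) :
    F.Contractible :=
  ⟨w⁻¹ • F.B, 0, by simp [hF.2, smul_smul, hw], by simp [hF.1, smul_smul, hw]⟩

theorem not_contractible_tensor {w : K} {E F : MF K} (hE : E.IsMF w) (hF : F.IsMF w)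
    (hE' : ¬ E.Contractible) (hF' : ¬ F.Contractible) : ¬ (E.tensor F).Contractible := by
  obtain rfl : w = 0 := by
    by_contra hw
    exact hE' (hE.contractible_of_ne_zero hw)
  rcases hasClass_of_not_contractible hE hE' with h | h <;>
    rcases hasClass_of_not_contractible hF hF' with h' | h'
  · exact (h.tensor_zero h').not_contractible
  · exact (h.tensor_one h').not_contractible
  · exact (h.tensor_zero h').not_contractible
  · exact (h.tensor_one h').not_contractible

end Field

theorem contractible_tensor_iff [IsLocalRing R] {w : R} {E F : MF R} (hE : E.IsMF w)
    (hF : F.IsMF w) : (E.tensor F).Contractible ↔ E.Contractible ∨ F.Contractible := by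
  refine ⟨fun h => ?_, fun h => h.elim (·.tensor_left F) (·.tensor_right E)⟩
  by_contra! hcon
  have hsurj := IsLocalRing.residue_surjective (R := R)
  have h' := h.map (IsLocalRing.residue R)
  rw [map_tensor] at h'
  exact not_contractible_tensor (hE.map _) (hF.map _)
    (fun c => hcon.1 (hE.contractible_of_map _ hsurj c))
    (fun c => hcon.2 (hF.contractible_of_map _ hsurj c)) h'

end MF

theorem stmt16 (R : Type) [CommRing R] (w : R)
    (E F : MF R) (hE : E.IsMF w) (hF : F.IsMF w) :
    (E.tensor F).Supp = E.Supp ∩ F.Supp := by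
  ext p
  simp only [MF.Supp, Set.mem_inter_iff, Set.mem_ofPred_eq, MF.map_tensor,
    MF.contractible_tensor_iff (hE.map _) (hF.map _), not_or]
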